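/- Let G be an L⁰-convexly compact subset of L⁰(𝓕,B) and H an a.s. bounded nonempty subset of L⁰(𝓕,B). Then the random Chebyshev center C(H,G) is a nonempty, closed, L⁰-convex subset of G. -/

import Mathlib

open MeasureTheory Set Filter Function
open scoped Classical

noncomputable section

namespace RNM


variable {Ω : Type*} [MeasurableSpace Ω] {P : Measure Ω}
variable {B : Type*} [NormedAddCommGroup B] [NormedSpace ℝ B]

/-- The pointwise norm of `x ∈ L⁰(𝓕,B)` as an element of `L⁰(𝓕,ℝ)`. -/
def nrm (x : Ω →ₘ[P] B) : Ω →ₘ[P] ℝ := x.comp norm continuous_norm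

/-- The module action of `L⁰(𝓕,ℝ)` on `L⁰(𝓕,B)` (pointwise scalar multiplication). -/
def msmul (l : Ω →ₘ[P] ℝ) (x : Ω →ₘ[P] B) : Ω →ₘ[P] B :=
  AEEqFun.comp₂ (fun c (b : B) => c • b) continuous_smul l x

/-- `Ĩ_A`, the equivalence class of the indicator function of `A`, in `L⁰(𝓕,ℝ)`. -/
def ind (A : Set Ω) (hA : MeasurableSet A) : Ω →ₘ[P] ℝ :=
  AEEqFun.mk (A.indicator fun _ => (1 : ℝ))
    ((measurable_const.indicator hA).aestronglyMeasurable)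

/-- A subset of `L⁰(𝓕,B)` is a.s. bounded if the norms of its members have a common
bound in `L⁰(𝓕,ℝ)`. -/
def ASBounded (H : Set (Ω →ₘ[P] B)) : Prop :=
  ∃ ξ : Ω →ₘ[P] ℝ, ∀ h ∈ H, nrm h ≤ ξ

/-- The supremum of a subset of `L⁰(𝓕,ℝ)` (junk value `0` if no least upper bound exists;
for nonempty a.s. bounded-above sets the least upper bound always exists, by Dedekind
completeness of `L⁰(𝓕,ℝ)`). -/
def lsup (S : Set (Ω →ₘ[P] ℝ)) : Ω →ₘ[P] ℝ :=
  if h : ∃ ξ, IsLUB S ξ then h.choose else 0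

/-- The infimum of a subset of `L⁰(𝓕,ℝ)` (junk value `0` if no greatest lower bound exists). -/
def linf (S : Set (Ω →ₘ[P] ℝ)) : Ω →ₘ[P] ℝ :=
  if h : ∃ ξ, IsGLB S ξ then h.choose else 0

/-- The random Chebyshev radius `R(H,x)` of `H` at `x`. -/
def Rr (H : Set (Ω →ₘ[P] B)) (x : Ω →ₘ[P] B) : Ω →ₘ[P] ℝ :=
  lsup ((fun y => nrm (x - y)) '' H)

/-- The random Chebyshev radius `R(H,G)` of `H` with respect to `G`. -/
def RrS (H G : Set (Ω →ₘ[P] B)) : Ω →ₘ[P] ℝ :=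
  linf ((fun x => Rr H x) '' G)

/-- The random Chebyshev center `C(H,G)` of `H` with respect to `G`. -/
def Cc (H G : Set (Ω →ₘ[P] B)) : Set (Ω →ₘ[P] B) :=
  {x ∈ G | Rr H x = RrS H G}

/-- The random diameter `D(H)`. -/
def Dd (H : Set (Ω →ₘ[P] B)) : Ω →ₘ[P] ℝ :=
  lsup {ξ | ∃ x ∈ H, ∃ y ∈ H, ξ = nrm (x - y)}

/-- A subset of `L⁰(𝓕,B)` is closed if it is sequentially closed under convergence in
probability (the `(ε,λ)`-topology). -/
def SeqClosed (S : Set (Ω →ₘ[P] B)) : Prop :=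
  ∀ (x : ℕ → Ω →ₘ[P] B) (y : Ω →ₘ[P] B), (∀ n, x n ∈ S) →
    TendstoInMeasure P (fun n => (x n : Ω → B)) atTop y → y ∈ S

/-- The closure of a subset of `L⁰(𝓕,B)` under convergence in probability. -/
def seqClosure (S : Set (Ω →ₘ[P] B)) : Set (Ω →ₘ[P] B) :=
  {y | ∃ x : ℕ → Ω →ₘ[P] B, (∀ n, x n ∈ S) ∧
    TendstoInMeasure P (fun n => (x n : Ω → B)) atTop y}

/-- `L⁰`-convexity. -/
def LConvex (G : Set (Ω →ₘ[P] B)) : Prop :=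
  ∀ x ∈ G, ∀ y ∈ G, ∀ l : Ω →ₘ[P] ℝ, 0 ≤ l → l ≤ 1 →
    msmul l x + msmul (1 - l) y ∈ G

/-- `L⁰`-convex compactness: `G` is a nonempty closed `L⁰`-convex set such that every family
of nonempty closed `L⁰`-convex subsets of `G` with the finite intersection property has
nonempty intersection. -/
def ConvexlyCompact (G : Set (Ω →ₘ[P] B)) : Prop :=
  G.Nonempty ∧ SeqClosed G ∧ LConvex G ∧
    ∀ 𝒞 : Set (Set (Ω →ₘ[P] B)),
      (∀ C ∈ 𝒞, C.Nonempty ∧ C ⊆ G ∧ SeqClosed C ∧ LConvex C) →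
      (∀ S : Finset (Set (Ω →ₘ[P] B)), ↑S ⊆ 𝒞 → (⋂₀ (S : Set (Set (Ω →ₘ[P] B)))).Nonempty) →
      (⋂₀ 𝒞).Nonempty

/-- Random normal structure. -/
def RandNormalStructure (G : Set (Ω →ₘ[P] B)) : Prop :=
  ∀ H ⊆ G, H.Nonempty → ASBounded H → SeqClosed H → LConvex H → Dd H ≠ 0 →
    ∃ z ∈ H, ∀ᵐ ω ∂P, 0 < Dd H ω → Rr H z ω < Dd H ω

/-- A nonexpansive mapping (on `G`). -/
def NonexpansiveOn (G : Set (Ω →ₘ[P] B)) (T : (Ω →ₘ[P] B) → (Ω →ₘ[P] B)) : Prop :=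
  ∀ x ∈ G, ∀ y ∈ G, nrm (T x - T y) ≤ nrm (x - y)

/-- An isometric mapping (on `G`). -/
def IsometricOn (G : Set (Ω →ₘ[P] B)) (T : (Ω →ₘ[P] B) → (Ω →ₘ[P] B)) : Prop :=
  ∀ x ∈ G, ∀ y ∈ G, nrm (T x - T y) = nrm (x - y)

/-- A countable measurable partition of `Ω`. -/
def IsPartition (A : ℕ → Set Ω) : Prop :=
  (∀ n, MeasurableSet (A n)) ∧ Pairwise (Disjoint on A) ∧ (⋃ n, A n) = univ

/-- `y` is the countable concatenation `Σ_n Ĩ_{A_n} x_n`,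
i.e. `y` agrees a.s. with `x n` on `A n` for each `n`. -/
def IsConcat (A : ℕ → Set Ω) (x : ℕ → Ω →ₘ[P] B) (y : Ω →ₘ[P] B) : Prop :=
  ∀ n, ∀ᵐ ω ∂P, ω ∈ A n → y ω = x n ω

/-- `G` is σ-stable: it contains all countable concatenations of its members along
countable measurable partitions of `Ω`. -/
def SigmaStable (G : Set (Ω →ₘ[P] B)) : Prop :=
  ∀ A : ℕ → Set Ω, IsPartition A → ∀ x : ℕ → Ω →ₘ[P] B, (∀ n, x n ∈ G) →
    ∀ y, IsConcat A x y → y ∈ G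

/-- The σ-stable hull of `G`. -/
def sigmaHull (G : Set (Ω →ₘ[P] B)) : Set (Ω →ₘ[P] B) :=
  {y | ∃ A : ℕ → Set Ω, IsPartition A ∧
    ∃ x : ℕ → Ω →ₘ[P] B, (∀ n, x n ∈ G) ∧ IsConcat A x y}

/-- The countable concatenation `Σ_n Ĩ_{A_n} H_n` of a sequence of sets. -/
def concatSet (A : ℕ → Set Ω) (H : ℕ → Set (Ω →ₘ[P] B)) : Set (Ω →ₘ[P] B) :=
  {y | ∃ x : ℕ → Ω →ₘ[P] B, (∀ n, x n ∈ H n) ∧ IsConcat A x y}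

/-- A finitely stable subset of `L⁰(𝓕,B)`. -/
def FinStable (G : Set (Ω →ₘ[P] B)) : Prop :=
  ∀ x ∈ G, ∀ y ∈ G, ∀ A : Set Ω, ∀ hA : MeasurableSet A,
    msmul (ind A hA) x + msmul (ind Aᶜ hA.compl) y ∈ G


theorem exists_isLUB_aux {Ω : Type*} [MeasurableSpace Ω] {P : Measure Ω} [IsProbabilityMeasure P]
    (S : Set (Ω →ₘ[P] ℝ)) (hne : S.Nonempty) (hbd : BddAbove S) : ∃ ξ, IsLUB S ξ := by
  obtain ⟨s, hs⟩ := hne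
  have hint : ∀ u : Ω →ₘ[P] ℝ, Integrable (fun ω => Real.arctan (u ω)) P := by
    intro u
    refine Integrable.of_bound
      (Real.continuous_arctan.comp_aestronglyMeasurable u.aestronglyMeasurable) (Real.pi / 2) ?_
    refine Eventually.of_forall fun ω => ?_
    rw [Real.norm_eq_abs]
    exact abs_le.mpr ⟨(Real.neg_pi_div_two_lt_arctan _).le, (Real.arctan_lt_pi_div_two _).le⟩
  let I : (Ω →ₘ[P] ℝ) → ℝ := fun u => ∫ ω, Real.arctan (u ω) ∂P
  have hImono : ∀ u v : Ω →ₘ[P] ℝ, u ≤ v → I u ≤ I v := by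
    intro u v huv
    refine integral_mono_ae (hint u) (hint v) ?_
    filter_upwards [AEEqFun.coeFn_le.mpr huv] with ω h
    exact Real.arctan_mono h
  have hbelow : BddBelow (I '' upperBounds S) := by
    refine ⟨I s, ?_⟩
    rintro _ ⟨u, hu, rfl⟩
    exact hImono _ _ (hu hs)
  have hne' : (I '' upperBounds S).Nonempty := Set.Nonempty.image _ hbd
  obtain ⟨a, -, ha, haU⟩ := exists_seq_tendsto_sInf hne' hbelow
  choose u hu hua using haU
  let gf : Ω → ℝ := fun ω => ⨅ n, u n ω
  have hgm : AEMeasurable gf P := AEMeasurable.iInf fun n => (u n).aemeasurable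
  let g : Ω →ₘ[P] ℝ := AEEqFun.mk gf hgm.aestronglyMeasurable
  have hg : ∀ᵐ ω ∂P, g ω = ⨅ n, u n ω := AEEqFun.coeFn_mk _ _
  have hsu : ∀ᵐ ω ∂P, ∀ n, s ω ≤ u n ω :=
    ae_all_iff.mpr fun n => AEEqFun.coeFn_le.mpr (hu n hs)
  have hgU : g ∈ upperBounds S := by
    intro f hf
    have hfu : ∀ᵐ ω ∂P, ∀ n, f ω ≤ u n ω :=
      ae_all_iff.mpr fun n => AEEqFun.coeFn_le.mpr (hu n hf)
    refine AEEqFun.coeFn_le.mp ?_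
    filter_upwards [hg, hfu] with ω h1 h2
    rw [h1]
    exact le_ciInf h2
  have hgu : ∀ n, g ≤ u n := by
    intro n
    refine AEEqFun.coeFn_le.mp ?_
    filter_upwards [hg, hsu] with ω h1 h2
    rw [h1]
    refine ciInf_le ⟨s ω, ?_⟩ n
    rintro _ ⟨m, rfl⟩
    exact h2 m
  have hIg : I g ≤ sInf (I '' upperBounds S) := by
    refine ge_of_tendsto' ha fun n => ?_
    rw [← hua n]
    exact hImono _ _ (hgu n)
  refine ⟨g, hgU, ?_⟩
  intro v hv
  have hm : g ⊓ v ∈ upperBounds S := fun f hf => le_inf (hgU hf) (hv hf)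
  have h1 : I g ≤ I (g ⊓ v) := hIg.trans (csInf_le hbelow ⟨_, hm, rfl⟩)
  have hle : ∀ᵐ ω ∂P, Real.arctan ((g ⊓ v : Ω →ₘ[P] ℝ) ω) ≤ Real.arctan (g ω) := by
    filter_upwards [AEEqFun.coeFn_le.mpr (inf_le_left : g ⊓ v ≤ g)] with ω h
    exact Real.arctan_mono h
  have heq : I (g ⊓ v) = I g := le_antisymm (hImono _ _ inf_le_left) h1
  have hae := (integral_eq_iff_of_ae_le (hint (g ⊓ v)) (hint g) hle).mp heq
  refine AEEqFun.coeFn_le.mp ?_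
  filter_upwards [hae, AEEqFun.coeFn_inf g v] with ω h2 h3
  have h4 := Real.arctan_injective h2
  rw [h3] at h4
  exact inf_eq_left.mp h4

section aux
variable {Ω : Type*} [MeasurableSpace Ω] {P : Measure Ω}
variable {B : Type*} [NormedAddCommGroup B] [NormedSpace ℝ B]

theorem nrm_sub_le_iff (x y : Ω →ₘ[P] B) (r : Ω →ₘ[P] ℝ) :
    nrm (x - y) ≤ r ↔ ∀ᵐ ω ∂P, ‖x ω - y ω‖ ≤ r ω := by
  rw [← AEEqFun.coeFn_le]
  have h1 : ∀ᵐ ω ∂P, nrm (x - y) ω = ‖x ω - y ω‖ := by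
    filter_upwards [AEEqFun.coeFn_comp norm continuous_norm (x - y), AEEqFun.coeFn_sub x y]
      with ω h1 h2
    rw [nrm, h1, comp_apply, h2, Pi.sub_apply]
  refine eventually_congr ?_
  filter_upwards [h1] with ω h
  rw [h]

theorem comb_coe (l : Ω →ₘ[P] ℝ) (x y : Ω →ₘ[P] B) :
    ∀ᵐ ω ∂P, (msmul l x + msmul (1 - l) y : Ω →ₘ[P] B) ω = l ω • x ω + (1 - l ω) • y ω := by
  filter_upwards [AEEqFun.coeFn_add (msmul l x) (msmul (1 - l) y),
    AEEqFun.coeFn_comp₂ (fun c (b : B) => c • b) continuous_smul l x,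
    AEEqFun.coeFn_comp₂ (fun c (b : B) => c • b) continuous_smul (1 - l) y,
    AEEqFun.coeFn_sub (1 : Ω →ₘ[P] ℝ) l, AEEqFun.coeFn_one (α := Ω) (μ := P) (β := ℝ)]
    with ω h1 h2 h3 h4 h5
  rw [h1, Pi.add_apply, msmul, msmul, h2, h3, h4, Pi.sub_apply, h5, Pi.one_apply]

/-- Points of `G` at distance at most `r` from every member of `H`. -/
def Ks (H G : Set (Ω →ₘ[P] B)) (r : Ω →ₘ[P] ℝ) : Set (Ω →ₘ[P] B) :=
  {x ∈ G | ∀ h ∈ H, nrm (x - h) ≤ r}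

theorem Ks_closed (H G : Set (Ω →ₘ[P] B)) (r : Ω →ₘ[P] ℝ) (hG : SeqClosed G) :
    SeqClosed (Ks H G r) := by
  intro x y hx hxy
  refine ⟨hG x y (fun n => (hx n).1) hxy, fun h hh => ?_⟩
  rw [nrm_sub_le_iff]
  obtain ⟨ns, -, hns⟩ := hxy.exists_seq_tendsto_ae
  have hall : ∀ᵐ ω ∂P, ∀ n, ‖x n ω - h ω‖ ≤ r ω :=
    ae_all_iff.mpr fun n => (nrm_sub_le_iff _ _ _).mp ((hx n).2 h hh)
  filter_upwards [hns, hall] with ω h1 h2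
  exact le_of_tendsto' ((h1.sub_const (h ω)).norm) fun n => h2 (ns n)

theorem Ks_convex (H G : Set (Ω →ₘ[P] B)) (r : Ω →ₘ[P] ℝ) (hG : LConvex G) :
    LConvex (Ks H G r) := by
  intro x hx y hy l h0 h1
  refine ⟨hG x hx.1 y hy.1 l h0 h1, fun h hh => ?_⟩
  rw [nrm_sub_le_iff]
  filter_upwards [comb_coe l x y, (nrm_sub_le_iff _ _ _).mp (hx.2 h hh),
    (nrm_sub_le_iff _ _ _).mp (hy.2 h hh), AEEqFun.coeFn_le.mpr h0, AEEqFun.coeFn_le.mpr h1,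
    AEEqFun.coeFn_zero (α := Ω) (μ := P) (β := ℝ), AEEqFun.coeFn_one (α := Ω) (μ := P) (β := ℝ)]
    with ω e1 e2 e3 e4 e5 e6 e7
  rw [e6, Pi.zero_apply] at e4
  rw [e7, Pi.one_apply] at e5
  have := convex_closedBall (h ω) (r ω) (mem_closedBall_iff_norm.mpr e2)
    (mem_closedBall_iff_norm.mpr e3) e4 (sub_nonneg.mpr e5) (by ring)
  rw [e1]
  exact mem_closedBall_iff_norm.mp this

theorem Rr_isLUB [IsProbabilityMeasure P] (H : Set (Ω →ₘ[P] B)) (hHne : H.Nonempty)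
    (hHbd : ASBounded H) (x : Ω →ₘ[P] B) :
    IsLUB ((fun y => nrm (x - y)) '' H) (Rr H x) := by
  have hex : ∃ ξ, IsLUB ((fun y => nrm (x - y)) '' H) ξ := by
    refine exists_isLUB_aux _ (hHne.image _) ?_
    obtain ⟨ξ, hξ⟩ := hHbd
    refine ⟨nrm x + ξ, ?_⟩
    rintro _ ⟨y, hy, rfl⟩
    refine (nrm_sub_le_iff _ _ _).mpr ?_
    filter_upwards [AEEqFun.coeFn_add (nrm x) ξ, AEEqFun.coeFn_comp norm continuous_norm x,
      AEEqFun.coeFn_comp norm continuous_norm y, AEEqFun.coeFn_le.mpr (hξ y hy)] with ω e1 e2 e3 e4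
    rw [nrm, e3, comp_apply] at e4
    rw [e1, Pi.add_apply, nrm, e2, comp_apply]
    exact (norm_sub_le _ _).trans (by linarith)
  rw [Rr, lsup, dif_pos hex]
  exact hex.choose_spec

theorem Rr_le_iff [IsProbabilityMeasure P] (H : Set (Ω →ₘ[P] B)) (hHne : H.Nonempty)
    (hHbd : ASBounded H) (x : Ω →ₘ[P] B) (r : Ω →ₘ[P] ℝ) :
    Rr H x ≤ r ↔ ∀ h ∈ H, nrm (x - h) ≤ r := by
  rw [isLUB_le_iff (Rr_isLUB H hHne hHbd x), mem_upperBounds, forall_mem_image]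

theorem Rr_directed [IsProbabilityMeasure P] (H : Set (Ω →ₘ[P] B)) (hHne : H.Nonempty)
    (hHbd : ASBounded H) (G : Set (Ω →ₘ[P] B)) (hG : LConvex G) (x y : Ω →ₘ[P] B)
    (hx : x ∈ G) (hy : y ∈ G) : ∃ z ∈ G, Rr H z ≤ Rr H x ∧ Rr H z ≤ Rr H y := by
  let A : Set Ω := {ω | Rr H x ω ≤ Rr H y ω}
  have hA : MeasurableSet A :=
    measurableSet_le (Rr H x).measurable (Rr H y).measurable
  have hind : ∀ᵐ ω ∂P, (ind A hA : Ω →ₘ[P] ℝ) ω = A.indicator (fun _ => (1 : ℝ)) ω :=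
    AEEqFun.coeFn_mk _ _
  have h0 : (0 : Ω →ₘ[P] ℝ) ≤ ind A hA := by
    refine AEEqFun.coeFn_le.mp ?_
    filter_upwards [hind, AEEqFun.coeFn_zero (α := Ω) (μ := P) (β := ℝ)] with ω e1 e2
    rw [e1, e2]
    exact indicator_nonneg (fun _ _ => zero_le_one) _
  have h1 : (ind A hA : Ω →ₘ[P] ℝ) ≤ 1 := by
    refine AEEqFun.coeFn_le.mp ?_
    filter_upwards [hind, AEEqFun.coeFn_one (α := Ω) (μ := P) (β := ℝ)] with ω e1 e2
    rw [e1, e2]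
    exact indicator_le_self' (fun _ _ => zero_le_one) _
  refine ⟨_, hG x hx y hy (ind A hA) h0 h1, le_inf_iff.mp ?_⟩
  rw [Rr_le_iff H hHne hHbd]
  intro h hh
  rw [nrm_sub_le_iff]
  filter_upwards [comb_coe (ind A hA) x y, hind, AEEqFun.coeFn_inf (Rr H x) (Rr H y),
    (nrm_sub_le_iff _ _ _).mp ((Rr_le_iff H hHne hHbd x _).mp le_rfl h hh),
    (nrm_sub_le_iff _ _ _).mp ((Rr_le_iff H hHne hHbd y _).mp le_rfl h hh)] with ω e1 e2 e3 e4 e5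
  rw [e1, e2, e3]
  by_cases hω : ω ∈ A
  · have hω' : Rr H x ω ≤ Rr H y ω := hω
    simp only [indicator_of_mem hω, one_smul, sub_self, zero_smul, add_zero]
    exact le_inf e4 (e4.trans hω')
  · have hω' : Rr H y ω ≤ Rr H x ω := (not_le.mp hω).le
    simp only [indicator_of_notMem hω, one_smul, sub_zero, zero_smul, zero_add]
    exact le_inf (e5.trans hω') e5

end aux

/-- For an `L⁰`-convexly compact `G` and an a.s. bounded nonempty `H`, the random Chebyshev
center `C(H,G)` is a nonempty closed `L⁰`-convex subset of `G`. -/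
theorem Cc_nonempty_closed_convex
    {Ω : Type*} [MeasurableSpace Ω] {P : Measure Ω} [IsProbabilityMeasure P]
    {B : Type*} [NormedAddCommGroup B] [NormedSpace ℝ B] [CompleteSpace B]
    (G : Set (Ω →ₘ[P] B)) (hG : ConvexlyCompact G)
    (H : Set (Ω →ₘ[P] B)) (hHne : H.Nonempty) (hHbd : ASBounded H) :
    (Cc H G).Nonempty ∧ SeqClosed (Cc H G) ∧ LConvex (Cc H G) ∧ Cc H G ⊆ G := by
  obtain ⟨⟨g0, hg0⟩, hcl, hcv, hcomp⟩ := hG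
  have hle := Rr_le_iff H hHne hHbd
  have hmin : ∃ x ∈ G, ∀ z ∈ G, Rr H x ≤ Rr H z := by
    obtain ⟨x, hx⟩ := hcomp ((fun z => Ks H G (Rr H z)) '' G) (by
      rintro _ ⟨z, hz, rfl⟩
      exact ⟨⟨z, hz, (hle z _).mp le_rfl⟩, fun _ h => h.1, Ks_closed H G _ hcl,
        Ks_convex H G _ hcv⟩) (by
      intro S hS
      have key : ∃ z ∈ G, ∀ C ∈ S, z ∈ C := by
        have main : ∀ T : Finset (Set (Ω →ₘ[P] B)), T ⊆ S →
            ∃ z ∈ G, ∀ C ∈ T, ∃ w ∈ G, C = Ks H G (Rr H w) ∧ Rr H z ≤ Rr H w := by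
          intro T
          induction T using Finset.induction_on with
          | empty => exact fun _ => ⟨g0, hg0, by simp⟩
          | insert C T _ ih =>
            intro hT
            obtain ⟨z, hz, hzT⟩ := ih fun D hD => hT (Finset.mem_insert_of_mem hD)
            obtain ⟨w, hw, hwC⟩ := hS (hT (Finset.mem_insert_self C T))
            obtain ⟨v, hv, hvz, hvw⟩ := Rr_directed H hHne hHbd G hcv z w hz hw
            refine ⟨v, hv, fun D hD => ?_⟩
            rcases Finset.mem_insert.mp hD with rfl | hD
            · exact ⟨w, hw, hwC.symm, hvw⟩
            · obtain ⟨q, hq, hqD, hzq⟩ := hzT D hD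
              exact ⟨q, hq, hqD, hvz.trans hzq⟩
        obtain ⟨z, hz, hzS⟩ := main S (Finset.Subset.refl S)
        refine ⟨z, hz, fun C hC => ?_⟩
        obtain ⟨w, -, rfl, hzw⟩ := hzS C hC
        exact ⟨hz, (hle z _).mp hzw⟩
      obtain ⟨z, -, hz⟩ := key
      exact ⟨z, fun C hC => hz C hC⟩)
    refine ⟨x, (hx _ ⟨g0, hg0, rfl⟩).1, fun z hz => (hle x _).mpr (hx _ ⟨z, hz, rfl⟩).2⟩
  obtain ⟨x, hxG, hx⟩ := hmin
  have hleast : IsLeast ((fun x => Rr H x) '' G) (Rr H x) := by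
    refine ⟨⟨x, hxG, rfl⟩, ?_⟩
    rintro _ ⟨z, hz, rfl⟩
    exact hx z hz
  have hR : RrS H G = Rr H x := by
    have hex : ∃ ξ, IsGLB ((fun x => Rr H x) '' G) ξ := ⟨_, hleast.isGLB⟩
    rw [RrS, linf, dif_pos hex]
    exact hex.choose_spec.unique hleast.isGLB
  have hC : Cc H G = Ks H G (Rr H x) := by
    ext z
    constructor
    · rintro ⟨hz, h⟩
      exact ⟨hz, (hle z _).mp (h.trans hR).le⟩
    · rintro ⟨hz, h⟩
      exact ⟨hz, (le_antisymm ((hle z _).mpr h) (hx z hz)).trans hR.symm⟩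
  refine ⟨⟨x, hxG, hR.symm⟩, ?_, ?_, fun _ h => h.1⟩
  · rw [hC]
    exact Ks_closed H G _ hcl
  · rw [hC]
    exact Ks_convex H G _ hcv

end RNM
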